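/- Let N ≥ 2, M ∈ ℕ, D ∈ ℕ₊ and ε ∈ (0,1). Let t ∈ C(ℝ^N × ℝ^M) be compactly supported with |t(q,q')| ≤ C|q|^{D−ε} for all (q,q'). Let F : ℝ^N → ℂ be absolutely integrable, smooth on ℝ^N∖{0}, and satisfy |∂^γ F(k)| ≤ C_γ |k|^{−(N−1+|γ|)} for all k ≠ 0 and all multi-indices γ with |γ| ≤ D+1. Then there exist t' ∈ C(ℝ^N × ℝ^M) and c_γ ∈ C(ℝ^M) for multi-indices γ with |γ| ≤ D such that ∫ t(k,q') F(q−k) d^N k/(2π)^N = t'(q,q') + Σ_{|γ|≤D} c_γ(q') q^γ for all (q,q') ∈ ℝ^N × ℝ^M, and |t'(q,q')| ≤ C' |q|^{D+1−ε} on all of ℝ^N × ℝ^M for some constant C'. -/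

import Mathlib

open MeasureTheory SchwartzMap Filter Topology

noncomputable section

abbrev Euc (N : ℕ) : Type := EuclideanSpace ℝ (Fin N)

/-- Partial derivative (in the `i`-th coordinate direction) of a plain function. -/
def pd {N : ℕ} (i : Fin N) (f : Euc N → ℂ) : Euc N → ℂ :=
  fun x => fderiv ℝ f x (EuclideanSpace.single i 1)

/-- Iterated partial derivative `∂^γ` of a plain function. -/
def pdMulti {N : ℕ} (γ : Fin N → ℕ) (f : Euc N → ℂ) : Euc N → ℂ :=
  (Finset.univ.toList (α := Fin N)).foldr (fun i F => (pd i)^[γ i] F) f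

/-- The monomial `q^γ`. -/
def mono {N : ℕ} (γ : Fin N → ℕ) (q : Euc N) : ℂ :=
  ∏ i, (q i : ℂ) ^ (γ i)

/-- Iterated partial derivative along a word of coordinate indices. -/
def pdWord {N : ℕ} (l : List (Fin N)) (F : Euc N → ℂ) : Euc N → ℂ :=
  l.foldr pd F

lemma pd_contDiffOn {N : ℕ} {G : Euc N → ℂ} (hG : ContDiffOn ℝ (⊤ : ℕ∞) G {(0 : Euc N)}ᶜ)
    (i : Fin N) : ContDiffOn ℝ (⊤ : ℕ∞) (pd i G) {(0 : Euc N)}ᶜ :=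
  (hG.fderiv_of_isOpen isOpen_compl_singleton le_rfl).clm_apply contDiffOn_const

lemma pdWord_contDiffOn {N : ℕ} {F : Euc N → ℂ} (hF : ContDiffOn ℝ (⊤ : ℕ∞) F {(0 : Euc N)}ᶜ)
    (l : List (Fin N)) : ContDiffOn ℝ (⊤ : ℕ∞) (pdWord l F) {(0 : Euc N)}ᶜ := by
  induction l with
  | nil => exact hF
  | cons i l ih => exact pd_contDiffOn ih i

lemma contDiffAt_of_compl_zero {N : ℕ} {G : Euc N → ℂ}
    (hG : ContDiffOn ℝ (⊤ : ℕ∞) G {(0 : Euc N)}ᶜ) {x : Euc N} (hx : x ≠ 0) :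
    ContDiffAt ℝ (⊤ : ℕ∞) G x :=
  hG.contDiffAt (isOpen_compl_singleton.mem_nhds hx)

lemma pd_comm {N : ℕ} {G : Euc N → ℂ} (hG : ContDiffOn ℝ (⊤ : ℕ∞) G {(0 : Euc N)}ᶜ)
    (i j : Fin N) {x : Euc N} (hx : x ≠ 0) : pd i (pd j G) x = pd j (pd i G) x := by
  have hd : DifferentiableAt ℝ (fderiv ℝ G) x :=
    ((hG.fderiv_of_isOpen (m := (⊤ : ℕ∞)) isOpen_compl_singleton le_rfl).contDiffAt
      (isOpen_compl_singleton.mem_nhds hx)).differentiableAt (by simp)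
  have key : ∀ i j : Fin N, pd i (pd j G) x
      = fderiv ℝ (fderiv ℝ G) x (EuclideanSpace.single i 1) (EuclideanSpace.single j 1) := by
    intro i j
    have h : HasFDerivAt (fun y => fderiv ℝ G y (EuclideanSpace.single j 1)) _ x :=
      hd.hasFDerivAt.clm_apply (hasFDerivAt_const (EuclideanSpace.single j (1 : ℝ)) x)
    change fderiv ℝ (fun y => fderiv ℝ G y (EuclideanSpace.single j 1)) x _ = _
    rw [h.fderiv]
    simp
  rw [key, key]
  refine ((contDiffAt_of_compl_zero hG hx).isSymmSndFDerivAt ?_) _ _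
  simpa using (WithTop.coe_le_coe.2 (le_top : (2 : ℕ∞) ≤ ⊤))

lemma pd_congr {N : ℕ} {G H : Euc N → ℂ} (h : Set.EqOn G H {(0 : Euc N)}ᶜ) (i : Fin N) :
    Set.EqOn (pd i G) (pd i H) {(0 : Euc N)}ᶜ := by
  intro x hx
  have : G =ᶠ[𝓝 x] H := h.eventuallyEq_of_mem (isOpen_compl_singleton.mem_nhds hx)
  simp only [pd, this.fderiv_eq]

lemma pdWord_perm {N : ℕ} {F : Euc N → ℂ} (hF : ContDiffOn ℝ (⊤ : ℕ∞) F {(0 : Euc N)}ᶜ)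
    {l l' : List (Fin N)} (h : l.Perm l') :
    Set.EqOn (pdWord l F) (pdWord l' F) {(0 : Euc N)}ᶜ := by
  induction h with
  | nil => exact fun _ _ => rfl
  | cons i _ ih => exact pd_congr ih i
  | swap i j l => exact fun x hx => pd_comm (pdWord_contDiffOn hF l) _ _ hx
  | trans _ _ ih₁ ih₂ => exact ih₁.trans ih₂

lemma foldr_iterate_pd {N : ℕ} (γ : Fin N → ℕ) (F : Euc N → ℂ) (l : List (Fin N)) :
    l.foldr (fun i G => (pd i)^[γ i] G) F
      = pdWord (l.flatMap fun i => List.replicate (γ i) i) F := by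
  induction l with
  | nil => rfl
  | cons i l ih =>
    have h : ∀ (n : ℕ) (G : Euc N → ℂ), (List.replicate n i).foldr pd G = (pd i)^[n] G := by
      intro n G
      induction n with
      | zero => rfl
      | succ n ihn => rw [List.replicate_succ, List.foldr_cons, ihn, Function.iterate_succ_apply']
    rw [List.foldr_cons, ih, List.flatMap_cons, pdWord, pdWord, List.foldr_append, h]

lemma pdWord_eq_pdMulti {N : ℕ} {F : Euc N → ℂ}
    (hF : ContDiffOn ℝ (⊤ : ℕ∞) F {(0 : Euc N)}ᶜ) (l : List (Fin N)) :
    Set.EqOn (pdWord l F) (pdMulti (fun i => l.count i) F) {(0 : Euc N)}ᶜ := by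
  rw [pdMulti, foldr_iterate_pd]
  refine pdWord_perm hF (List.perm_iff_count.2 fun a => ?_)
  rw [List.count_flatMap]
  simp [Function.comp_def, List.count_replicate, Finset.sum_map_toList]

lemma exists_pdWord_bound {N D : ℕ} {F : Euc N → ℂ}
    (hF : ContDiffOn ℝ (⊤ : ℕ∞) F {(0 : Euc N)}ᶜ)
    (hFder : ∀ γ : Fin N → ℕ, (∑ i, γ i) ≤ D → ∃ Cγ : ℝ,
      ∀ k : Euc N, k ≠ 0 →
        ‖pdMulti γ F k‖ ≤ Cγ * ‖k‖ ^ (-((N : ℝ) - 1 + ((∑ i, γ i : ℕ) : ℝ)))) :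
    ∃ A : ℝ, 0 ≤ A ∧ ∀ l : List (Fin N), l.length ≤ D → ∀ k : Euc N, k ≠ 0 →
      ‖pdWord l F k‖ ≤ A * ‖k‖ ^ (-((N : ℝ) - 1 + (l.length : ℝ))) := by
  have h1 : ∀ l : List (Fin N), ∃ B : ℝ, l.length ≤ D → ∀ k : Euc N, k ≠ 0 →
      ‖pdWord l F k‖ ≤ B * ‖k‖ ^ (-((N : ℝ) - 1 + (l.length : ℝ))) := by
    intro l
    by_cases hl : l.length ≤ D
    · have hs : ∑ i, l.count i = l.length := by
        have := Multiset.sum_count_eq_card (s := Finset.univ) (m := (l : Multiset (Fin N)))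
          (fun a _ => Finset.mem_univ a)
        simpa using this
      obtain ⟨B, hB⟩ := hFder (fun i => l.count i) (hs.trans_le hl)
      refine ⟨B, fun _ k hk => ?_⟩
      rw [pdWord_eq_pdMulti hF l hk]
      simpa only [hs] using hB k hk
    · exact ⟨0, fun h => absurd h hl⟩
  choose B hB using h1
  obtain ⟨A, hA⟩ := ((List.finite_length_le (Fin N) D).image B).bddAbove
  refine ⟨max A 0, le_max_right _ _, fun l hl k hk => (hB l hl k hk).trans ?_⟩
  gcongr
  exact (hA ⟨l, hl, rfl⟩).trans (le_max_left _ _)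

/-- The `n`-th order homogeneous term of the Taylor expansion of `F` at `x`, without `1 / n!`. -/
def taylorTerm {N : ℕ} (n : ℕ) (q : Euc N) (F : Euc N → ℂ) (x : Euc N) : ℂ :=
  ∑ r : Fin n → Fin N, (∏ j, (q (r j) : ℂ)) * pdWord (List.ofFn r) F x

lemma fderiv_eq_sum_pd {N : ℕ} (G : Euc N → ℂ) (x q : Euc N) :
    fderiv ℝ G x q = ∑ i, (q i : ℂ) * pd i G x := by
  conv_lhs => rw [← (EuclideanSpace.basisFun (Fin N) ℝ).sum_repr q]
  simp [pd, map_sum]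

lemma hasDerivAt_taylorTerm {N : ℕ} {F : Euc N → ℂ}
    (hF : ContDiffOn ℝ (⊤ : ℕ∞) F {(0 : Euc N)}ᶜ) (n : ℕ) (q y : Euc N) {s : ℝ}
    (hs : s • q + y ≠ 0) :
    HasDerivAt (fun s : ℝ => taylorTerm n q F (s • q + y))
      (taylorTerm (n + 1) q F (s • q + y)) s := by
  have h1 : ∀ r : Fin n → Fin N, HasDerivAt (fun s : ℝ => pdWord (List.ofFn r) F (s • q + y))
      (∑ i, (q i : ℂ) * pdWord (List.ofFn (Fin.cons i r : Fin (n + 1) → Fin N)) F (s • q + y)) s := by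
    intro r
    have hd : DifferentiableAt ℝ (pdWord (List.ofFn r) F) (s • q + y) :=
      (contDiffAt_of_compl_zero (pdWord_contDiffOn hF _) hs).differentiableAt (by simp)
    have hl : HasDerivAt (fun s : ℝ => s • q + y) q s := by
      simpa using ((hasDerivAt_id s).smul_const q).add_const y
    have := hd.hasFDerivAt.comp_hasDerivAt s hl
    rw [fderiv_eq_sum_pd] at this
    simp only [List.ofFn_cons]
    exact this
  have h2 := HasDerivAt.fun_sum (u := Finset.univ)
    (fun (r : Fin n → Fin N) _ => (h1 r).const_mul (∏ j, (q (r j) : ℂ)))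
  refine h2.congr_deriv ?_
  rw [taylorTerm, ← (Fin.consEquiv fun _ => Fin N).sum_comp, Fintype.sum_prod_type_right]
  refine Finset.sum_congr rfl fun r _ => ?_
  rw [Finset.mul_sum]
  refine Finset.sum_congr rfl fun i _ => ?_
  simp only [Fin.consEquiv, Equiv.coe_fn_mk, Fin.prod_univ_succ, Fin.cons_zero, Fin.cons_succ]
  ring

lemma norm_sub_taylor_le {g : ℕ → ℝ → ℂ} {B : ℝ} (n : ℕ)
    (hg : ∀ j ≤ n, ∀ s ∈ Set.Icc (0 : ℝ) 1, HasDerivAt (g j) (g (j + 1) s) s)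
    (hB : ∀ s ∈ Set.Icc (0 : ℝ) 1, ‖g (n + 1) s‖ ≤ B) :
    ‖g 0 1 - ∑ j ∈ Finset.range (n + 1), ((j.factorial : ℂ))⁻¹ * g j 0‖ ≤ B := by
  have key : ∀ m ≤ n, ∀ s ∈ Set.Icc (0 : ℝ) 1, HasDerivAt
      (fun s : ℝ => ∑ j ∈ Finset.range (m + 1), ((1 - s : ℝ) : ℂ) ^ j * ((j.factorial : ℂ))⁻¹ * g j s)
      (((1 - s : ℝ) : ℂ) ^ m * ((m.factorial : ℂ))⁻¹ * g (m + 1) s) s := by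
    intro m
    induction m with
    | zero => intro h s hs; simpa using hg 0 h s hs
    | succ m ih =>
      intro h s hs
      have hc : HasDerivAt (fun s : ℝ => ((1 - s : ℝ) : ℂ)) (-1) s := by
        simpa using ((hasDerivAt_id s).const_sub 1).ofReal_comp
      have := (ih (by omega) s hs).add
        (((hc.pow (m + 1)).mul_const ((m + 1).factorial : ℂ)⁻¹).mul (hg (m + 1) h s hs))
      have e : (fun s : ℝ => ∑ j ∈ Finset.range (m + 1 + 1),
          ((1 - s : ℝ) : ℂ) ^ j * ((j.factorial : ℂ))⁻¹ * g j s)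
          = fun s : ℝ => (∑ j ∈ Finset.range (m + 1),
            ((1 - s : ℝ) : ℂ) ^ j * ((j.factorial : ℂ))⁻¹ * g j s)
            + ((1 - s : ℝ) : ℂ) ^ (m + 1) * (((m + 1).factorial : ℂ))⁻¹ * g (m + 1) s := by
        funext s; rw [Finset.sum_range_succ]
      rw [e]
      refine this.congr_deriv ?_
      have h1 : ((m.factorial : ℕ) : ℂ) ≠ 0 := by exact_mod_cast m.factorial_ne_zero
      have h2 : (m : ℂ) + 1 ≠ 0 := by exact_mod_cast m.succ_ne_zero
      simp only [Nat.factorial_succ, Nat.cast_mul, Nat.cast_add, Nat.cast_one, Nat.add_sub_cancel,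
        Pi.pow_apply]
      field_simp
      ring
  have := norm_image_sub_le_of_norm_deriv_le_segment_01' (C := B)
    (fun s hs => (key n le_rfl s hs).hasDerivWithinAt) (fun s hs => by
      have hs' : s ∈ Set.Icc (0 : ℝ) 1 := ⟨hs.1, hs.2.le⟩
      rw [norm_mul, norm_mul, norm_pow, norm_inv, Complex.norm_real, Complex.norm_natCast]
      have h1 : ‖1 - s‖ ^ n ≤ 1 := pow_le_one₀ (norm_nonneg _) (by
        rw [Real.norm_eq_abs, abs_le]; constructor <;> linarith [hs'.1, hs'.2])
      have h2 : ((n.factorial : ℝ))⁻¹ ≤ 1 := inv_le_one_of_one_le₀ (by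
        exact_mod_cast n.factorial_pos)
      have h3 : ‖1 - s‖ ^ n * ((n.factorial : ℝ))⁻¹ ≤ 1 := mul_le_one₀ h1 (by positivity) h2
      calc _ ≤ 1 * B := mul_le_mul h3 (hB s hs') (norm_nonneg _) zero_le_one
        _ = B := one_mul B)
  rw [Finset.sum_range_succ'] at this
  simpa using this

lemma norm_pdWord_mul_le {N n : ℕ} {F : Euc N → ℂ} {b : ℝ} {x q : Euc N} (r : Fin n → Fin N)
    (hb : ‖pdWord (List.ofFn r) F x‖ ≤ b) :
    ‖(∏ j, (q (r j) : ℂ)) * pdWord (List.ofFn r) F x‖ ≤ ‖q‖ ^ n * b := by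
  rw [norm_mul]
  refine mul_le_mul ?_ hb (norm_nonneg _) (by positivity)
  rw [norm_prod]
  calc _ ≤ ∏ _j : Fin n, ‖q‖ := Finset.prod_le_prod (fun _ _ => norm_nonneg _) fun j _ => by
        rw [Complex.norm_real]; exact PiLp.norm_apply_le q (r j)
    _ = ‖q‖ ^ n := by simp

lemma norm_taylorTerm_le {N n : ℕ} {F : Euc N → ℂ} {b : ℝ} {x : Euc N} (q : Euc N)
    (hb : ∀ r : Fin n → Fin N, ‖pdWord (List.ofFn r) F x‖ ≤ b) :
    ‖taylorTerm n q F x‖ ≤ N ^ n * (‖q‖ ^ n * b) := by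
  refine (norm_sum_le_of_le _ fun r _ => norm_pdWord_mul_le r (hb r)).trans ?_
  simp

lemma integral_rpow_norm_ball {N : ℕ} (hN : 0 < N) {p : ℝ} (hp : -(N : ℝ) < p) :
    ∃ K : ℝ, ∀ R : ℝ, 0 < R →
      Integrable (fun x : Euc N => (Set.Iio R).indicator (fun y : ℝ => y ^ p) ‖x‖) ∧
      ∫ x : Euc N, (Set.Iio R).indicator (fun y : ℝ => y ^ p) ‖x‖ = K * R ^ (N + p) := by
  have : Nontrivial (Euc N) := Module.nontrivial_of_finrank_pos (R := ℝ) (by simpa using hN)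
  refine ⟨N * (volume.real (Metric.ball (0 : Euc N) 1) * (N + p)⁻¹), fun R hR => ?_⟩
  have e : Set.EqOn (fun y : ℝ => y ^ (N - 1) • (Set.Iio R).indicator (fun y : ℝ => y ^ p) y)
      ((Set.Iio R).indicator (fun y : ℝ => y ^ ((N : ℝ) - 1 + p))) (Set.Ioi 0) := by
    intro y hy
    simp only [Set.indicator, smul_eq_mul]
    split_ifs
    · rw [Real.rpow_add hy, ← Nat.cast_pred hN, Real.rpow_natCast]
    · simp
  have hset : Set.Iio R ∩ Set.Ioi 0 = Set.Ioo 0 R := by ext; simp [and_comm]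
  constructor
  · rw [integrable_fun_norm_addHaar volume (f := (Set.Iio R).indicator (fun y : ℝ => y ^ p)),
      finrank_euclideanSpace_fin, integrableOn_congr_fun e measurableSet_Ioi,
      integrableOn_indicator_iff measurableSet_Iio, hset,
      intervalIntegral.integrableOn_Ioo_rpow_iff hR]
    linarith
  · rw [integral_fun_norm_addHaar volume ((Set.Iio R).indicator (fun y : ℝ => y ^ p)),
      finrank_euclideanSpace_fin, setIntegral_congr_fun measurableSet_Ioi e,
      setIntegral_indicator measurableSet_Iio, Set.inter_comm, hset, ← integral_Ioc_eq_integral_Ioo,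
      ← intervalIntegral.integral_of_le hR.le, integral_rpow (Or.inl (by linarith)),
      Real.zero_rpow (by linarith)]
    simp only [nsmul_eq_mul, smul_eq_mul]
    rw [show (N : ℝ) - 1 + p + 1 = N + p by ring]
    ring

lemma integral_rpow_norm_compl_ball {N : ℕ} (hN : 0 < N) {p : ℝ} (hp : p < -(N : ℝ)) :
    ∃ K : ℝ, ∀ R : ℝ, 0 < R →
      Integrable (fun x : Euc N => (Set.Ici R).indicator (fun y : ℝ => y ^ p) ‖x‖) ∧
      ∫ x : Euc N, (Set.Ici R).indicator (fun y : ℝ => y ^ p) ‖x‖ = K * R ^ (N + p) := by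
  have : Nontrivial (Euc N) := Module.nontrivial_of_finrank_pos (R := ℝ) (by simpa using hN)
  refine ⟨N * (volume.real (Metric.ball (0 : Euc N) 1) * (-(N + p))⁻¹), fun R hR => ?_⟩
  have e : Set.EqOn (fun y : ℝ => y ^ (N - 1) • (Set.Ici R).indicator (fun y : ℝ => y ^ p) y)
      ((Set.Ici R).indicator (fun y : ℝ => y ^ ((N : ℝ) - 1 + p))) (Set.Ioi 0) := by
    intro y hy
    simp only [Set.indicator, smul_eq_mul]
    split_ifs
    · rw [Real.rpow_add hy, ← Nat.cast_pred hN, Real.rpow_natCast]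
    · simp
  have hset : Set.Ioi 0 ∩ Set.Ici R = Set.Ici R :=
    Set.inter_eq_right.2 fun y hy => hR.trans_le hy
  constructor
  · rw [integrable_fun_norm_addHaar volume (f := (Set.Ici R).indicator (fun y : ℝ => y ^ p)),
      finrank_euclideanSpace_fin, integrableOn_congr_fun e measurableSet_Ioi,
      integrableOn_indicator_iff measurableSet_Ici, Set.inter_comm, hset,
      integrableOn_Ici_iff_integrableOn_Ioi]
    exact integrableOn_Ioi_rpow_of_lt (by linarith) hR
  · rw [integral_fun_norm_addHaar volume ((Set.Ici R).indicator (fun y : ℝ => y ^ p)),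
      finrank_euclideanSpace_fin, setIntegral_congr_fun measurableSet_Ioi e,
      setIntegral_indicator measurableSet_Ici, hset, integral_Ici_eq_integral_Ioi,
      integral_Ioi_rpow_of_lt (by linarith) hR]
    simp only [nsmul_eq_mul, smul_eq_mul]
    rw [show (N : ℝ) - 1 + p + 1 = N + p by ring, inv_neg]
    ring

lemma norm_sub_taylor_far_le {N D : ℕ} {F : Euc N → ℂ} {A : ℝ} (hN : 0 < N)
    (hF : ContDiffOn ℝ (⊤ : ℕ∞) F {(0 : Euc N)}ᶜ) (hA : 0 ≤ A)
    (hFA : ∀ l : List (Fin N), l.length ≤ D + 1 → ∀ k : Euc N, k ≠ 0 →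
      ‖pdWord l F k‖ ≤ A * ‖k‖ ^ (-((N : ℝ) - 1 + (l.length : ℝ))))
    {q k : Euc N} (hk : k ≠ 0) (hqk : 2 * ‖q‖ ≤ ‖k‖) :
    ‖F (q - k) - ∑ n ∈ Finset.range (D + 1), (n.factorial : ℂ)⁻¹ * taylorTerm n q F (-k)‖
      ≤ N ^ (D + 1) * (‖q‖ ^ (D + 1) * (A * (2 ^ (N + D) * ‖k‖ ^ (-((N : ℝ) + D))))) := by
  have hk0 : 0 < ‖k‖ := norm_pos_iff.2 hk
  have hlow : ∀ s ∈ Set.Icc (0 : ℝ) 1, ‖k‖ / 2 ≤ ‖s • q + -k‖ := by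
    intro s hs
    have h1 : ‖s • q‖ ≤ ‖q‖ := by
      rw [norm_smul, Real.norm_eq_abs, abs_of_nonneg hs.1]
      exact mul_le_of_le_one_left (norm_nonneg _) hs.2
    have h2 := norm_sub_norm_le (-k) (-(s • q))
    rw [norm_neg, norm_neg, sub_neg_eq_add, add_comm (-k)] at h2
    linarith
  have hne : ∀ s ∈ Set.Icc (0 : ℝ) 1, s • q + -k ≠ 0 := fun s hs =>
    norm_pos_iff.1 ((half_pos hk0).trans_le (hlow s hs))
  have := norm_sub_taylor_le (g := fun n s => taylorTerm n q F (s • q + -k)) D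
    (B := N ^ (D + 1) * (‖q‖ ^ (D + 1) * (A * (2 ^ (N + D) * ‖k‖ ^ (-((N : ℝ) + D))))))
    (fun j _ s hs => hasDerivAt_taylorTerm hF j q (-k) (hne s hs))
    (fun s hs => norm_taylorTerm_le q fun r => by
      refine (hFA _ (by simp) _ (hne s hs)).trans ?_
      refine mul_le_mul_of_nonneg_left ?_ hA
      have e : -((N : ℝ) - 1 + ((List.ofFn r).length : ℝ)) = -((N : ℝ) + D) := by
        rw [List.length_ofFn]; push_cast; ring
      rw [e]
      calc ‖s • q + -k‖ ^ (-((N : ℝ) + D)) ≤ (‖k‖ / 2) ^ (-((N : ℝ) + D)) :=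
            Real.rpow_le_rpow_of_nonpos (half_pos hk0) (hlow s hs)
              (neg_nonpos.2 (by positivity))
        _ = 2 ^ (N + D) * ‖k‖ ^ (-((N : ℝ) + D)) := by
            rw [Real.div_rpow hk0.le zero_le_two, Real.rpow_neg zero_le_two, div_inv_eq_mul,
              ← Nat.cast_add, Real.rpow_natCast, mul_comm])
  have e0 : ∀ x, taylorTerm 0 q F x = F x := fun x => by simp [taylorTerm, pdWord]
  simpa [e0, ← sub_eq_add_neg] using this

lemma exists_norm_integral_taylor_le {N D : ℕ} {F : Euc N → ℂ} {A ε C : ℝ} (hN : 0 < N)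
    (hD : 0 < D) (hε0 : 0 < ε) (hε1 : ε < 1)
    (hF : ContDiffOn ℝ (⊤ : ℕ∞) F {(0 : Euc N)}ᶜ) (hA : 0 ≤ A) (hC : 0 ≤ C)
    (hFA : ∀ l : List (Fin N), l.length ≤ D + 1 → ∀ k : Euc N, k ≠ 0 →
      ‖pdWord l F k‖ ≤ A * ‖k‖ ^ (-((N : ℝ) - 1 + (l.length : ℝ)))) :
    ∃ K : ℝ, ∀ f : Euc N → ℂ, (∀ k, ‖f k‖ ≤ C * ‖k‖ ^ ((D : ℝ) - ε)) → ∀ q : Euc N,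
      ‖∫ k, f k * (F (q - k)
        - ∑ n ∈ Finset.range (D + 1), (n.factorial : ℂ)⁻¹ * taylorTerm n q F (-k))‖
      ≤ K * ‖q‖ ^ ((D : ℝ) + 1 - ε) := by
  have hD1 : (1 : ℝ) ≤ D := by exact_mod_cast hD
  have : Nontrivial (Euc N) := Module.nontrivial_of_finrank_pos (R := ℝ) (by simpa using hN)
  obtain ⟨K₁, h₁⟩ := integral_rpow_norm_ball hN (p := -((N : ℝ) - 1)) (by linarith)
  have h2 : ∀ n : ℕ, n < D + 1 → ∃ K : ℝ, ∀ R : ℝ, 0 < R →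
      Integrable (fun x : Euc N => (Set.Iio R).indicator
        (fun y : ℝ => y ^ ((D : ℝ) - ε + -((N : ℝ) - 1 + n))) ‖x‖) ∧
      ∫ x : Euc N, (Set.Iio R).indicator
        (fun y : ℝ => y ^ ((D : ℝ) - ε + -((N : ℝ) - 1 + n))) ‖x‖
        = K * R ^ (N + ((D : ℝ) - ε + -((N : ℝ) - 1 + n))) := by
    intro n hn
    have : (n : ℝ) ≤ D := by exact_mod_cast Nat.lt_succ_iff.1 hn
    exact integral_rpow_norm_ball hN (by linarith)
  choose! K₂ h₂ using h2
  obtain ⟨K₃, h₃⟩ := integral_rpow_norm_compl_ball hN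
    (p := (D : ℝ) - ε + -((N : ℝ) + D)) (by linarith)
  refine ⟨C * A * (2 ^ ((D : ℝ) - ε) * K₁ * 3
    + (∑ n ∈ Finset.range (D + 1), (N : ℝ) ^ n * K₂ n * 2 ^ ((D : ℝ) + 1 - ε - n))
    + N ^ (D + 1) * 2 ^ (N + D) * K₃ * 2 ^ (-ε)), fun f hf q => ?_⟩
  rcases eq_or_ne q 0 with rfl | hq
  · rw [norm_zero, Real.zero_rpow (by linarith), mul_zero]
    refine (norm_integral_le_of_norm_le (g := fun _ => (0 : ℝ)) (integrable_zero _ _ _) ?_).trans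
      (by simp)
    filter_upwards [Measure.ae_ne volume (0 : Euc N)] with k hk
    have := norm_sub_taylor_far_le (q := 0) hN hF hA hFA hk (by simp)
    rw [norm_zero, zero_pow (Nat.succ_ne_zero D), zero_mul, mul_zero] at this
    rw [norm_mul, le_antisymm this (norm_nonneg _), mul_zero]
  have hb : 0 < ‖q‖ := norm_pos_iff.2 hq
  set b := ‖q‖ with hbdef
  have i₁ := ((h₁ (3 * b) (by positivity)).1.comp_sub_left q).const_mul
    (C * A * (2 * b) ^ ((D : ℝ) - ε))
  have i₂ := integrable_finsetSum (Finset.range (D + 1)) fun n hn =>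
    ((h₂ n (Finset.mem_range.1 hn) (2 * b) (by positivity)).1.const_mul (C * A * (N ^ n * b ^ n)))
  have i₃ := (h₃ (2 * b) (by positivity)).1.const_mul
    (C * A * (N ^ (D + 1) * b ^ (D + 1) * 2 ^ (N + D)))
  refine (norm_integral_le_of_norm_le ((i₁.add i₂).add i₃) ?_).trans (le_of_eq ?_)
  · filter_upwards [Measure.ae_ne volume (0 : Euc N), Measure.ae_ne volume q] with k hk hkq
    have hk0 : 0 < ‖k‖ := norm_pos_iff.2 hk
    simp only [Pi.add_apply]
    rw [norm_mul]
    have n₁ : 0 ≤ C * A * (2 * b) ^ ((D : ℝ) - ε) * (Set.Iio (3 * b)).indicator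
        (fun y : ℝ => y ^ (-((N : ℝ) - 1))) ‖q - k‖ :=
      mul_nonneg (by positivity) (Set.indicator_apply_nonneg fun _ => by positivity)
    have n₂ : 0 ≤ ∑ n ∈ Finset.range (D + 1), C * A * (N ^ n * b ^ n) * (Set.Iio (2 * b)).indicator
        (fun y : ℝ => y ^ ((D : ℝ) - ε + -((N : ℝ) - 1 + n))) ‖k‖ :=
      Finset.sum_nonneg fun n _ =>
        mul_nonneg (by positivity) (Set.indicator_apply_nonneg fun _ => by positivity)
    rcases lt_or_ge ‖k‖ (2 * b) with hlt | hge
    · have hqk : ‖q - k‖ < 3 * b := by linarith [norm_sub_le q k]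
      rw [Set.indicator_of_notMem (s := Set.Ici (2 * b)) (by simpa using hlt), mul_zero, add_zero,
        Set.indicator_of_mem (s := Set.Iio (3 * b)) hqk]
      simp only [Set.indicator_of_mem (s := Set.Iio (2 * b)) hlt]
      refine (mul_le_mul_of_nonneg_left (norm_sub_le _ _) (norm_nonneg _)).trans ?_
      rw [mul_add]
      refine add_le_add ?_ ?_
      · have hF0 := hFA [] (by simp) (q - k) (sub_ne_zero.2 hkq.symm)
        simp only [List.length_nil, Nat.cast_zero, add_zero] at hF0
        have hf' : ‖f k‖ ≤ C * (2 * b) ^ ((D : ℝ) - ε) := (hf k).trans (by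
          have : 0 ≤ (D : ℝ) - ε := by linarith
          gcongr)
        calc _ ≤ (C * (2 * b) ^ ((D : ℝ) - ε)) * (A * ‖q - k‖ ^ (-((N : ℝ) - 1))) :=
              mul_le_mul hf' hF0 (norm_nonneg _) (by positivity)
          _ = _ := by ring
      · refine (mul_le_mul_of_nonneg_left (norm_sum_le _ _) (norm_nonneg _)).trans ?_
        rw [Finset.mul_sum]
        refine Finset.sum_le_sum fun n hn => ?_
        have hn' : n < D + 1 := Finset.mem_range.1 hn
        have hT : ‖taylorTerm n q F (-k)‖
            ≤ N ^ n * (b ^ n * (A * ‖k‖ ^ (-((N : ℝ) - 1 + n)))) :=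
          norm_taylorTerm_le q fun r => by
            simpa using hFA (List.ofFn r) (by simpa using hn'.le) (-k) (neg_ne_zero.2 hk)
        have hT' : ‖(n.factorial : ℂ)⁻¹ * taylorTerm n q F (-k)‖
            ≤ N ^ n * (b ^ n * (A * ‖k‖ ^ (-((N : ℝ) - 1 + n)))) := by
          rw [norm_mul, norm_inv, Complex.norm_natCast]
          refine (mul_le_of_le_one_left (norm_nonneg _) ?_).trans hT
          exact inv_le_one_of_one_le₀ (by exact_mod_cast n.factorial_pos)
        calc _ ≤ (C * ‖k‖ ^ ((D : ℝ) - ε))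
                * (N ^ n * (b ^ n * (A * ‖k‖ ^ (-((N : ℝ) - 1 + n))))) :=
              mul_le_mul (hf k) hT' (norm_nonneg _) (by positivity)
          _ = _ := by rw [Real.rpow_add hk0]; ring
    · refine le_trans ?_ (le_add_of_nonneg_left (add_nonneg n₁ n₂))
      rw [Set.indicator_of_mem (s := Set.Ici (2 * b)) hge, Real.rpow_add hk0]
      calc _ ≤ (C * ‖k‖ ^ ((D : ℝ) - ε)) *
            (N ^ (D + 1) * (b ^ (D + 1) * (A * (2 ^ (N + D) * ‖k‖ ^ (-((N : ℝ) + D)))))) :=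
              mul_le_mul (hf k) (norm_sub_taylor_far_le hN hF hA hFA hk hge)
                (norm_nonneg _) (by positivity)
          _ = _ := by ring
  · have s₁ : C * A * (2 * b) ^ ((D : ℝ) - ε) * (K₁ * (3 * b) ^ ((N : ℝ) + -((N : ℝ) - 1)))
        = C * A * (2 ^ ((D : ℝ) - ε) * K₁ * 3) * b ^ ((D : ℝ) + 1 - ε) := by
      rw [show (N : ℝ) + -((N : ℝ) - 1) = 1 by ring, Real.rpow_one,
        Real.mul_rpow zero_le_two hb.le, show (D : ℝ) + 1 - ε = (D - ε) + 1 by ring,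
        Real.rpow_add hb, Real.rpow_one]
      ring
    have s₂ : ∀ n : ℕ, C * A * (N ^ n * b ^ n)
          * (K₂ n * (2 * b) ^ ((N : ℝ) + ((D : ℝ) - ε + -((N : ℝ) - 1 + n))))
        = C * A * (N ^ n * K₂ n * 2 ^ ((D : ℝ) + 1 - ε - n)) * b ^ ((D : ℝ) + 1 - ε) := by
      intro n
      have : b ^ ((D : ℝ) + 1 - ε) = b ^ n * b ^ ((D : ℝ) + 1 - ε - n) := by
        rw [← Real.rpow_natCast b n, ← Real.rpow_add hb]; congr 1; ring
      rw [this, show (N : ℝ) + ((D : ℝ) - ε + -((N : ℝ) - 1 + n)) = (D : ℝ) + 1 - ε - n by ring,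
        Real.mul_rpow zero_le_two hb.le]
      ring
    have s₃ : C * A * (N ^ (D + 1) * b ^ (D + 1) * 2 ^ (N + D))
          * (K₃ * (2 * b) ^ ((N : ℝ) + ((D : ℝ) - ε + -((N : ℝ) + D))))
        = C * A * (N ^ (D + 1) * 2 ^ (N + D) * K₃ * 2 ^ (-ε)) * b ^ ((D : ℝ) + 1 - ε) := by
      have : b ^ ((D : ℝ) + 1 - ε) = b ^ (D + 1) * b ^ (-ε) := by
        rw [← Real.rpow_natCast b (D + 1), ← Real.rpow_add hb]; congr 1; push_cast; ring
      rw [this, show (N : ℝ) + ((D : ℝ) - ε + -((N : ℝ) + D)) = -ε by ring,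
        Real.mul_rpow zero_le_two hb.le]
      ring
    rw [integral_add' (i₁.add i₂) i₃, integral_add' i₁ i₂, integral_finsetSum _ fun n hn =>
      ((h₂ n (Finset.mem_range.1 hn) (2 * b) (by positivity)).1.const_mul _)]
    simp only [integral_const_mul]
    rw [integral_sub_left_eq_self (fun x : Euc N =>
        (Set.Iio (3 * b)).indicator (fun y : ℝ => y ^ (-((N : ℝ) - 1))) ‖x‖) volume q,
      (h₁ (3 * b) (by positivity)).2, (h₃ (2 * b) (by positivity)).2, s₁, s₃,
      Finset.sum_congr rfl fun n hn => by
        rw [(h₂ n (Finset.mem_range.1 hn) (2 * b) (by positivity)).2, s₂ n],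
      ← Finset.sum_mul, ← Finset.mul_sum]
    ring

/-- The number of occurrences of each index in a word. -/
def wordMultiIndex {N n : ℕ} (r : Fin n → Fin N) : Fin N → ℕ :=
  fun i => (Finset.univ.filter fun j => r j = i).card

lemma mono_wordMultiIndex {N n : ℕ} (r : Fin n → Fin N) (q : Euc N) :
    mono (wordMultiIndex r) q = ∏ j, (q (r j) : ℂ) := by
  rw [mono, ← Finset.prod_fiberwise Finset.univ r]
  refine Finset.prod_congr rfl fun i _ => ?_
  rw [Finset.prod_congr rfl (g := fun _ => (q i : ℂ)), Finset.prod_const, wordMultiIndex]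
  intro j hj
  rw [(Finset.mem_filter.1 hj).2]

lemma sum_wordMultiIndex {N n : ℕ} (r : Fin n → Fin N) : ∑ i, wordMultiIndex r i = n := by
  have := Finset.card_eq_sum_card_fiberwise (s := Finset.univ) (t := Finset.univ) (f := r)
    (fun _ _ => Finset.mem_coe.2 (Finset.mem_univ _))
  simpa [wordMultiIndex] using this.symm

lemma continuous_mono {N : ℕ} (γ : Fin N → ℕ) : Continuous (mono γ) := by
  unfold mono
  fun_prop

lemma finite_multiIndex_le (N D : ℕ) : {γ : Fin N → ℕ | (∑ i, γ i) ≤ D}.Finite :=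
  (Set.finite_Iic (fun _ : Fin N => D)).subset fun _ hγ i =>
    (Finset.single_le_sum (fun _ _ => Nat.zero_le _) (Finset.mem_univ i)).trans hγ

lemma continuous_convolution_param {N M : ℕ} {t : Euc N × Euc M → ℂ} (ht : Continuous t)
    (htsupp : HasCompactSupport t) {F : Euc N → ℂ} (hF : Integrable F) :
    Continuous fun x : Euc N × Euc M => ∫ k : Euc N, t (k, x.2) * F (x.1 - k) := by
  obtain ⟨B, hB⟩ := htsupp.exists_bound_of_continuous ht
  have e : (fun x : Euc N × Euc M => ∫ k : Euc N, t (k, x.2) * F (x.1 - k))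
      = fun x => ∫ k : Euc N, t (x.1 - k, x.2) * F k := by
    funext x
    rw [← integral_sub_left_eq_self (fun k => t (x.1 - k, x.2) * F k) volume x.1]
    simp
  rw [e]
  refine continuous_of_dominated (bound := fun k => B * ‖F k‖) (fun x => ?_) (fun x => ?_)
    (hF.norm.const_mul B) ?_
  · exact (Continuous.aestronglyMeasurable (by fun_prop)).mul hF.aestronglyMeasurable
  · refine Eventually.of_forall fun k => ?_
    rw [norm_mul]
    exact mul_le_mul_of_nonneg_right (hB _) (norm_nonneg _)
  · exact Eventually.of_forall fun k => by fun_prop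

lemma integrable_and_continuous_moment {N M D : ℕ} {ε C A : ℝ} (hN : 0 < N) (hε1 : ε < 1)
    (hC : 0 ≤ C) {t : Euc N × Euc M → ℂ} (ht : Continuous t) (htsupp : HasCompactSupport t)
    (hbound : ∀ x : Euc N × Euc M, ‖t x‖ ≤ C * ‖x.1‖ ^ ((D : ℝ) - ε))
    {F : Euc N → ℂ} (hF : ContDiffOn ℝ (⊤ : ℕ∞) F {(0 : Euc N)}ᶜ) {l : List (Fin N)}
    (hl : l.length ≤ D)
    (hFA : ∀ k : Euc N, k ≠ 0 → ‖pdWord l F k‖ ≤ A * ‖k‖ ^ (-((N : ℝ) - 1 + (l.length : ℝ)))) :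
    (∀ q' : Euc M, Integrable fun k : Euc N => t (k, q') * pdWord l F (-k)) ∧
      Continuous fun q' : Euc M => ∫ k : Euc N, t (k, q') * pdWord l F (-k) := by
  have : Nontrivial (Euc N) := Module.nontrivial_of_finrank_pos (R := ℝ) (by simpa using hN)
  obtain ⟨R, hR0, hR⟩ := htsupp.isCompact.isBounded.exists_pos_norm_lt
  have hl' : (l.length : ℝ) ≤ D := by exact_mod_cast hl
  obtain ⟨K, hK⟩ := integral_rpow_norm_ball hN
    (p := (D : ℝ) - ε + -((N : ℝ) - 1 + l.length)) (by linarith)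
  have hint := (hK R hR0).1.const_mul (C * A)
  have hmeas : ∀ q' : Euc M, AEStronglyMeasurable
      (fun k : Euc N => t (k, q') * pdWord l F (-k)) volume := by
    intro q'
    refine (Continuous.aestronglyMeasurable (by fun_prop)).mul ?_
    have hc : ContinuousOn (fun k : Euc N => pdWord l F (-k)) {(0 : Euc N)}ᶜ :=
      (pdWord_contDiffOn hF l).continuousOn.comp continuous_neg.continuousOn
        fun k hk => neg_ne_zero.2 hk
    have := hc.aestronglyMeasurable (μ := volume) (measurableSet_singleton (0 : Euc N)).compl
    rwa [restrict_compl_singleton] at this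
  have hle : ∀ q' : Euc M, ∀ᵐ k : Euc N, ‖t (k, q') * pdWord l F (-k)‖
      ≤ C * A * (Set.Iio R).indicator
        (fun y : ℝ => y ^ ((D : ℝ) - ε + -((N : ℝ) - 1 + l.length))) ‖k‖ := by
    intro q'
    filter_upwards [Measure.ae_ne volume (0 : Euc N)] with k hk
    have hk0 : 0 < ‖k‖ := norm_pos_iff.2 hk
    by_cases hkR : ‖k‖ < R
    · have hFk := hFA (-k) (neg_ne_zero.2 hk)
      rw [norm_neg] at hFk
      rw [Set.indicator_of_mem (s := Set.Iio R) hkR, norm_mul, Real.rpow_add hk0]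
      calc _ ≤ (C * ‖k‖ ^ ((D : ℝ) - ε)) * (A * ‖k‖ ^ (-((N : ℝ) - 1 + (l.length : ℝ)))) :=
            mul_le_mul (hbound (k, q')) hFk (norm_nonneg _) (by positivity)
        _ = _ := by ring
    · have h0 : t (k, q') = 0 := by
        by_contra h
        exact hkR ((norm_fst_le (k, q')).trans_lt (hR _ (subset_tsupport t h)))
      rw [h0, Set.indicator_of_notMem (s := Set.Iio R) hkR]
      simp
  exact ⟨fun q' => hint.mono' (hmeas q') (hle q'),
    continuous_of_dominated hmeas hle hint (Eventually.of_forall fun k => by fun_prop)⟩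

/-- Lemma 2.17 of Duch.  Convolution of a compactly supported continuous
function bounded by `|q|^{D−ε}` with a kernel `F` having the decay properties of `Θ̂_β`
produces, up to a polynomial of degree `D` in `q` with continuous coefficients in `q'`,
a continuous function bounded by `|q|^{D+1−ε}`. -/
theorem stmt10 (N M : ℕ) (hN : 2 ≤ N) (D : ℕ) (hD : 0 < D)
    (ε : ℝ) (hε0 : 0 < ε) (hε1 : ε < 1)
    (t : Euc N × Euc M → ℂ) (ht : Continuous t) (htsupp : HasCompactSupport t)
    (C : ℝ) (hbound : ∀ x : Euc N × Euc M, ‖t x‖ ≤ C * ‖x.1‖ ^ ((D : ℝ) - ε))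
    (F : Euc N → ℂ) (hFint : Integrable F volume) (hFsmooth : ContDiffOn ℝ (⊤ : ℕ∞) F {(0 : Euc N)}ᶜ)
    (hFder : ∀ γ : Fin N → ℕ, (∑ i, γ i) ≤ D + 1 → ∃ Cγ : ℝ,
      ∀ k : Euc N, k ≠ 0 →
        ‖pdMulti γ F k‖ ≤ Cγ * ‖k‖ ^ (-((N : ℝ) - 1 + ((∑ i, γ i : ℕ) : ℝ)))) :
    ∃ t' : Euc N × Euc M → ℂ, Continuous t' ∧
    ∃ c : (Fin N → ℕ) → Euc M → ℂ,
      (∀ γ : Fin N → ℕ, (∑ i, γ i) ≤ D → Continuous (c γ)) ∧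
      (∀ q : Euc N, ∀ q' : Euc M,
        (((2 * Real.pi) ^ N : ℝ) : ℂ)⁻¹ * (∫ k : Euc N, t (k, q') * F (q - k))
          = t' (q, q') + ∑ᶠ γ ∈ {γ : Fin N → ℕ | (∑ i, γ i) ≤ D}, c γ q' * mono γ q) ∧
      (∃ C' : ℝ, ∀ q : Euc N, ∀ q' : Euc M,
        ‖t' (q, q')‖ ≤ C' * ‖q‖ ^ ((D : ℝ) + 1 - ε)) := by
  classical
  have hN0 : 0 < N := by omega
  obtain ⟨A, hA, hFA⟩ := exists_pdWord_bound hFsmooth hFder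
  have hbound' : ∀ x : Euc N × Euc M, ‖t x‖ ≤ |C| * ‖x.1‖ ^ ((D : ℝ) - ε) := fun x =>
    (hbound x).trans (by gcongr; exact le_abs_self C)
  obtain ⟨K, hK⟩ :=
    exists_norm_integral_taylor_le hN0 hD hε0 hε1 hFsmooth hA (abs_nonneg C) hFA
  set w : ℂ := (((2 * Real.pi) ^ N : ℝ) : ℂ)⁻¹ with hw
  have hmom : ∀ (n : ℕ) (_ : n < D + 1) (r : Fin n → Fin N),
      (∀ q' : Euc M, Integrable fun k : Euc N => t (k, q') * pdWord (List.ofFn r) F (-k)) ∧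
      Continuous fun q' : Euc M => ∫ k : Euc N, t (k, q') * pdWord (List.ofFn r) F (-k) :=
    fun n hn r => integrable_and_continuous_moment hN0 hε1 (abs_nonneg C) ht htsupp hbound'
      hFsmooth (by simpa using Nat.lt_succ_iff.1 hn) (hFA _ (by simpa using hn.le))
  let c : (Fin N → ℕ) → Euc M → ℂ := fun γ q' =>
    w * ∑ n ∈ Finset.range (D + 1), ∑ r : Fin n → Fin N, if wordMultiIndex r = γ then
      (n.factorial : ℂ)⁻¹ * ∫ k : Euc N, t (k, q') * pdWord (List.ofFn r) F (-k) else 0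
  have hc : ∀ γ, Continuous (c γ) := fun γ => by
    refine continuous_const.mul (continuous_finsetSum _ fun n hn =>
      continuous_finsetSum _ fun r _ => ?_)
    split_ifs
    · exact continuous_const.mul (hmom n (Finset.mem_range.1 hn) r).2
    · exact continuous_const
  let P : Euc N × Euc M → ℂ := fun x =>
    ∑ᶠ γ ∈ {γ : Fin N → ℕ | (∑ i, γ i) ≤ D}, c γ x.2 * mono γ x.1
  have hPfin : ∀ x, P x = ∑ γ ∈ (finite_multiIndex_le N D).toFinset, c γ x.2 * mono γ x.1 :=
    fun x => finsum_mem_eq_finite_toFinset_sum _ _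
  have hPcont : Continuous P := by
    rw [funext hPfin]
    exact continuous_finsetSum _ fun γ _ =>
      ((hc γ).comp continuous_snd).mul ((continuous_mono γ).comp continuous_fst)
  have hterm : ∀ (q : Euc N) (q' : Euc M) (n : ℕ), n < D + 1 →
      Integrable (fun k => t (k, q') * ((n.factorial : ℂ)⁻¹ * taylorTerm n q F (-k))) ∧
      ∫ k, t (k, q') * ((n.factorial : ℂ)⁻¹ * taylorTerm n q F (-k))
        = ∑ r : Fin n → Fin N, (n.factorial : ℂ)⁻¹ * (∏ j, (q (r j) : ℂ))
          * ∫ k : Euc N, t (k, q') * pdWord (List.ofFn r) F (-k) := by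
    intro q q' n hn
    have e : (fun k => t (k, q') * ((n.factorial : ℂ)⁻¹ * taylorTerm n q F (-k)))
        = fun k => ∑ r : Fin n → Fin N, (n.factorial : ℂ)⁻¹ * (∏ j, (q (r j) : ℂ))
          * (t (k, q') * pdWord (List.ofFn r) F (-k)) := by
      funext k
      rw [taylorTerm, Finset.mul_sum, Finset.mul_sum]
      exact Finset.sum_congr rfl fun r _ => by ring
    have hi : ∀ r ∈ (Finset.univ : Finset (Fin n → Fin N)), Integrable fun k : Euc N =>
        (n.factorial : ℂ)⁻¹ * (∏ j, (q (r j) : ℂ)) * (t (k, q') * pdWord (List.ofFn r) F (-k)) :=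
      fun r _ => ((hmom n hn r).1 q').const_mul _
    rw [e]
    refine ⟨integrable_finsetSum _ hi, ?_⟩
    rw [integral_finsetSum _ hi]
    simp only [integral_const_mul]
  have hP : ∀ q q', P (q, q') = w * ∑ n ∈ Finset.range (D + 1),
      ∫ k, t (k, q') * ((n.factorial : ℂ)⁻¹ * taylorTerm n q F (-k)) := by
    intro q q'
    simp only [hPfin, c, mul_assoc w, ← Finset.mul_sum]
    congr 1
    simp only [Finset.sum_mul]
    rw [Finset.sum_comm]
    refine Finset.sum_congr rfl fun n hn => ?_
    rw [(hterm q q' n (Finset.mem_range.1 hn)).2, Finset.sum_comm]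
    refine Finset.sum_congr rfl fun r _ => ?_
    simp only [ite_mul, zero_mul]
    rw [Finset.sum_ite_eq, if_pos, mono_wordMultiIndex]
    · ring
    · simpa [sum_wordMultiIndex] using Nat.lt_succ_iff.1 (Finset.mem_range.1 hn)
  obtain ⟨B, hB⟩ := htsupp.exists_bound_of_continuous ht
  refine ⟨fun x => w * (∫ k : Euc N, t (k, x.2) * F (x.1 - k)) - P x,
    (continuous_const.mul (continuous_convolution_param ht htsupp hFint)).sub hPcont, c,
    fun γ _ => hc γ, fun q q' => (sub_add_cancel _ _).symm, ‖w‖ * K, fun q q' => ?_⟩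
  have hconv : Integrable fun k : Euc N => t (k, q') * F (q - k) :=
    (hFint.comp_sub_left q).bdd_mul (c := B) (Continuous.aestronglyMeasurable (by fun_prop))
      (Eventually.of_forall fun k => hB _)
  have hti := fun n hn => (hterm q q' n (Finset.mem_range.1 hn)).1
  have key : w * (∫ k : Euc N, t (k, q') * F (q - k)) - P (q, q')
      = w * ∫ k, t (k, q') * (F (q - k)
        - ∑ n ∈ Finset.range (D + 1), (n.factorial : ℂ)⁻¹ * taylorTerm n q F (-k)) := by
    simp only [mul_sub, Finset.mul_sum]
    rw [integral_sub hconv (integrable_finsetSum _ hti), integral_finsetSum _ hti, hP, mul_sub]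
  simp only [key, norm_mul, mul_assoc]
  gcongr
  exact hK (fun k => t (k, q')) (fun k => hbound' (k, q')) q

end
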